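/- Let Ω ⊂ ℝ² be a bounded open set with C¹ boundary, let ρ∗ > 0, and let ρ ∈ L^∞(Ω) with 0 ≤ ρ ≤ ρ∗, u ∈ H¹(Ω). Then there is a constant C depending only on ρ∗ and Ω such that ‖√ρ·u‖²_{L⁴(Ω)} ≤ C·(1 + ‖√ρ·u‖_{L²(Ω)})·‖u‖_{H¹(Ω)}·log^{1/2}(2 + ‖u‖²_{H¹(Ω)}). -/

import Mathlib

open Real MeasureTheory

section Cone

variable {E : Type*} [NormedAddCommGroup E] [NormedSpace ℝ E]

lemma exists_cone_of_fderiv_ne_zero {f : E → ℝ} (hf : ContDiff ℝ 1 f) {x₀ : E}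
    (h : fderiv ℝ f x₀ ≠ 0) :
    ∃ r > 0, ∃ δ > 0, ∃ e : E, ∀ x ∈ Metric.ball x₀ r, f x < 0 →
      ∀ w ∈ Metric.ball e δ, ∀ s ∈ Set.Icc (0 : ℝ) 1, f (x + s • w) < 0 := by
  obtain ⟨v, hv⟩ : ∃ v, fderiv ℝ f x₀ v < 0 := by
    obtain ⟨v, hv⟩ : ∃ v, fderiv ℝ f x₀ v ≠ 0 := by
      by_contra! hcon
      exact h (ContinuousLinearMap.ext hcon)
    rcases hv.lt_or_gt with hv | hv
    · exact ⟨v, hv⟩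
    · exact ⟨-v, by simpa using hv⟩
  have hcont : Continuous fun p : E × E => fderiv ℝ f p.1 p.2 :=
    (hf.continuous_fderiv one_ne_zero).fst'.clm_apply continuous_snd
  have hev : ∀ᶠ p in nhds (x₀, v), fderiv ℝ f p.1 p.2 < 0 :=
    hcont.continuousAt.eventually_lt continuousAt_const hv
  obtain ⟨κ, hκ, hball⟩ := Metric.eventually_nhds_iff_ball.1 hev
  obtain ⟨t, ht0, ht⟩ : ∃ t : ℝ, 0 < t ∧ t * (‖v‖ + κ) < κ / 2 := by
    have hp : 0 < ‖v‖ + κ := by positivity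
    refine ⟨κ / 4 / (‖v‖ + κ), by positivity, ?_⟩
    rw [div_mul_cancel₀ _ hp.ne']
    linarith
  refine ⟨κ / 2, by positivity, t * κ, by positivity, t • v, fun x hx hfx w hw s hs => ?_⟩
  obtain ⟨z, hz, rfl⟩ : ∃ z ∈ Metric.ball v κ, w = t • z := by
    refine ⟨t⁻¹ • w, ?_, by rw [smul_inv_smul₀ ht0.ne']⟩
    rw [mem_ball_iff_norm] at hw ⊢
    have : w - t • v = t • (t⁻¹ • w - v) := by rw [smul_sub, smul_inv_smul₀ ht0.ne']
    rw [this, norm_smul, Real.norm_of_nonneg ht0.le] at hw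
    exact lt_of_mul_lt_mul_left hw ht0.le
  have hder : ∀ τ : ℝ, HasDerivAt (fun τ : ℝ => f (x + τ • t • z))
      (fderiv ℝ f (x + τ • t • z) (t • z)) τ := by
    intro τ
    have h1 : HasDerivAt (fun τ : ℝ => x + τ • t • z) (t • z) τ := by
      simpa using ((hasDerivAt_id τ).smul_const (t • z)).const_add x
    exact ((hf.differentiable one_ne_zero _).hasFDerivAt).comp_hasDerivAt τ h1
  have hanti : AntitoneOn (fun τ : ℝ => f (x + τ • t • z)) (Set.Icc 0 1) := by
    refine antitoneOn_of_deriv_nonpos (convex_Icc 0 1)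
      (fun τ _ => (hder τ).continuousAt.continuousWithinAt)
      (fun τ _ => (hder τ).differentiableAt.differentiableWithinAt) fun τ hτ => ?_
    rw [interior_Icc] at hτ
    rw [(hder τ).deriv, map_smul, smul_eq_mul]
    refine mul_nonpos_of_nonneg_of_nonpos ht0.le (hball (x + τ • t • z, z) ?_).le
    rw [← ball_prod_same]
    refine ⟨?_, hz⟩
    rw [mem_ball_iff_norm] at hx hz ⊢
    have h1 : ‖τ • t • z‖ ≤ t * (‖v‖ + κ) := by
      rw [norm_smul, norm_smul, Real.norm_of_nonneg hτ.1.le, Real.norm_of_nonneg ht0.le]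
      have h2 : ‖z‖ ≤ ‖v‖ + κ := by
        have := norm_le_norm_add_norm_sub v z
        rw [norm_sub_rev] at hz
        linarith
      calc τ * (t * ‖z‖) ≤ 1 * (t * ‖z‖) := by gcongr; exact hτ.2.le
        _ ≤ t * (‖v‖ + κ) := by rw [one_mul]; gcongr
    calc ‖x + τ • t • z - x₀‖ = ‖(x - x₀) + τ • t • z‖ := by congr 1; abel
      _ ≤ ‖x - x₀‖ + ‖τ • t • z‖ := norm_add_le _ _
      _ < κ := by linarith
  have := hanti (Set.left_mem_Icc.2 zero_le_one) hs hs.1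
  simp only [zero_smul, add_zero] at this
  exact this.trans_lt hfx

lemma exists_uniform_interior_cone {f : E → ℝ} (hf : ContDiff ℝ 1 f) {Ω : Set E}
    (hΩ : Ω = {x | f x < 0}) (hc : IsCompact (closure Ω))
    (hreg : ∀ x ∈ frontier Ω, fderiv ℝ f x ≠ 0) :
    ∃ δ > 0, ∀ x ∈ Ω, ∃ e : E, ∀ w ∈ Metric.ball e δ, ∀ s ∈ Set.Icc (0 : ℝ) 1,
      x + s • w ∈ Ω := by
  have hopen : IsOpen Ω := hΩ ▸ isOpen_lt hf.continuous continuous_const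
  suffices H : ∃ δ > 0, ∀ x ∈ closure Ω, x ∈ Ω → ∃ e : E, ∀ w ∈ Metric.ball e δ,
      ∀ s ∈ Set.Icc (0 : ℝ) 1, x + s • w ∈ Ω by
    obtain ⟨δ, hδ, h⟩ := H
    exact ⟨δ, hδ, fun x hx => h x (subset_closure hx) hx⟩
  refine hc.induction_on (p := fun S => ∃ δ > 0, ∀ x ∈ S, x ∈ Ω → ∃ e : E,
    ∀ w ∈ Metric.ball e δ, ∀ s ∈ Set.Icc (0 : ℝ) 1, x + s • w ∈ Ω) ?_ ?_ ?_ ?_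
  · exact ⟨1, one_pos, by simp⟩
  · intro s t hst ht
    obtain ⟨δ, hδ, h⟩ := ht
    exact ⟨δ, hδ, fun x hx => h x (hst hx)⟩
  · intro s t hs ht
    obtain ⟨δ, hδ, h⟩ := hs
    obtain ⟨δ', hδ', h'⟩ := ht
    refine ⟨min δ δ', lt_min hδ hδ', fun x hx hxΩ => ?_⟩
    rcases hx with hx | hx
    · obtain ⟨e, he⟩ := h x hx hxΩ
      exact ⟨e, fun w hw => he w (Metric.ball_subset_ball (min_le_left _ _) hw)⟩
    · obtain ⟨e, he⟩ := h' x hx hxΩ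
      exact ⟨e, fun w hw => he w (Metric.ball_subset_ball (min_le_right _ _) hw)⟩
  · intro x₀ hx₀
    by_cases hx₀Ω : x₀ ∈ Ω
    · obtain ⟨r, hr, hball⟩ := Metric.isOpen_iff.1 hopen x₀ hx₀Ω
      refine ⟨Metric.ball x₀ (r / 2), mem_nhdsWithin_of_mem_nhds
        (Metric.ball_mem_nhds _ (by positivity)), r / 2, by positivity,
        fun x hx _ => ⟨0, fun w hw s hs => hball ?_⟩⟩
      rw [mem_ball_iff_norm] at hx hw ⊢
      have h1 : ‖s • w‖ < r / 2 := by
        rw [norm_smul, Real.norm_of_nonneg hs.1]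
        rw [sub_zero] at hw
        exact (mul_le_of_le_one_left (norm_nonneg _) hs.2).trans_lt hw
      calc ‖x + s • w - x₀‖ = ‖(x - x₀) + s • w‖ := by congr 1; abel
        _ ≤ ‖x - x₀‖ + ‖s • w‖ := norm_add_le _ _
        _ < r := by linarith
    · have hfr : x₀ ∈ frontier Ω := ⟨hx₀, by rwa [hopen.interior_eq]⟩
      obtain ⟨r, hr, δ, hδ, e, he⟩ := exists_cone_of_fderiv_ne_zero hf (hreg x₀ hfr)
      refine ⟨Metric.ball x₀ r, mem_nhdsWithin_of_mem_nhds (Metric.ball_mem_nhds _ hr), δ, hδ,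
        fun x hx hxΩ => ⟨e, fun w hw s hs => ?_⟩⟩
      rw [hΩ] at hxΩ ⊢
      exact he x hx hxΩ w hw s hs

end Cone

section Segment

variable {E F : Type*} [NormedAddCommGroup E] [NormedSpace ℝ E]
  [NormedAddCommGroup F] [NormedSpace ℝ F]

lemma enorm_sub_le_lintegral_enorm_deriv {f : ℝ → F} [CompleteSpace F] (hf : Differentiable ℝ f) :
    ‖f 1 - f 0‖ₑ ≤ ∫⁻ s in Set.Ioc (0 : ℝ) 1, ‖deriv f s‖ₑ := by
  by_cases hfi : IntegrableOn (deriv f) (Set.Ioc 0 1)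
  · rw [← intervalIntegral.integral_eq_sub_of_hasDerivAt (fun x _ => (hf x).hasDerivAt)
      ((intervalIntegrable_iff_integrableOn_Ioc_of_le zero_le_one).2 hfi),
      intervalIntegral.integral_of_le zero_le_one]
    exact enorm_integral_le_lintegral_enorm _
  · have : ∫⁻ s in Set.Ioc (0 : ℝ) 1, ‖deriv f s‖ₑ = ⊤ := by
      by_contra hne
      exact hfi ⟨aestronglyMeasurable_deriv _ _, lt_top_iff_ne_top.2 hne⟩
    rw [this]
    exact le_top

lemma enorm_le_enorm_add_lintegral_segment [CompleteSpace F] {u : E → F} (hu : Differentiable ℝ u)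
    (x w : E) :
    ‖u x‖ₑ ≤ ‖u (x + w)‖ₑ +
      ∫⁻ s in Set.Ioc (0 : ℝ) 1, ‖fderiv ℝ u (x + s • w)‖ₑ * ‖w‖ₑ := by
  have hder : ∀ τ : ℝ, HasDerivAt (fun τ : ℝ => u (x + τ • w))
      (fderiv ℝ u (x + τ • w) w) τ := by
    intro τ
    have h1 : HasDerivAt (fun τ : ℝ => x + τ • w) w τ := by
      simpa using ((hasDerivAt_id τ).smul_const w).const_add x
    exact ((hu _).hasFDerivAt).comp_hasDerivAt τ h1
  have key := enorm_sub_le_lintegral_enorm_deriv (f := fun τ : ℝ => u (x + τ • w))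
    fun τ => (hder τ).differentiableAt
  simp only [one_smul, zero_smul, add_zero] at key
  calc ‖u x‖ₑ = ‖u (x + w) - (u (x + w) - u x)‖ₑ := by congr 1; abel
    _ ≤ ‖u (x + w)‖ₑ + ‖u (x + w) - u x‖ₑ := enorm_sub_le
    _ ≤ _ := by
      gcongr
      refine key.trans (lintegral_mono fun s => ?_)
      rw [(hder s).deriv]
      exact ContinuousLinearMap.le_opENorm _ _

end Segment

section Riesz

variable {E : Type*} [NormedAddCommGroup E] [NormedSpace ℝ E] [MeasurableSpace E] [BorelSpace E]
  [FiniteDimensional ℝ E]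

lemma lintegral_comp_smul_addHaar (μ : Measure E) [μ.IsAddHaarMeasure] {F : E → ENNReal}
    (hF : Measurable F) {s : ℝ} (hs : 0 < s) :
    ∫⁻ w, F (s • w) ∂μ = ENNReal.ofReal ((s ^ Module.finrank ℝ E)⁻¹) * ∫⁻ y, F y ∂μ := by
  rw [← lintegral_map hF (measurable_const_smul s), Measure.map_addHaar_smul μ hs.ne',
    lintegral_smul_measure, abs_of_pos (by positivity), smul_eq_mul]

lemma setLIntegral_inv_sq_le {a : ℝ} (ha : 0 < a) :
    ∫⁻ s in Set.Ici a, ENNReal.ofReal ((s ^ 2)⁻¹) ≤ ENNReal.ofReal a⁻¹ := by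
  rw [setLIntegral_congr Ioi_ae_eq_Ici.symm]
  have hcongr : ∀ s ∈ Set.Ioi a, (s ^ 2)⁻¹ = s ^ (-2 : ℝ) := fun s hs => by
    rw [Real.rpow_neg (ha.trans hs).le, Real.rpow_two]
  have hfi : IntegrableOn (fun s : ℝ => (s ^ 2)⁻¹) (Set.Ioi a) :=
    (integrableOn_congr_fun hcongr measurableSet_Ioi).2
      (integrableOn_Ioi_rpow_of_lt (by norm_num) ha)
  rw [← ofReal_integral_eq_lintegral_ofReal hfi (.of_forall fun s => by positivity),
    setIntegral_congr_fun measurableSet_Ioi hcongr, integral_Ioi_rpow_of_lt (by norm_num) ha]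
  refine ENNReal.ofReal_le_ofReal (le_of_eq ?_)
  norm_num
  rw [Real.rpow_neg_one]

lemma lintegral_cone_le [Nontrivial E] (μ : Measure E) [μ.IsAddHaarMeasure]
    (hdim : Module.finrank ℝ E = 2) {g : E → ENNReal} (hg : Measurable g) {D : ℝ} (hD : 0 < D)
    (x : E) :
    ∫⁻ s in Set.Ioc (0 : ℝ) 1, ∫⁻ w in Metric.closedBall (0 : E) D, g (x + s • w) ∂μ ≤
      ENNReal.ofReal D *
        ∫⁻ y in Metric.closedBall (0 : E) D, ENNReal.ofReal ‖y‖⁻¹ * g (x + y) ∂μ := by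
  have hgx : Measurable fun y => g (x + y) := hg.comp (measurable_const_add x)
  have hkm : Measurable fun y => ENNReal.ofReal ‖y‖⁻¹ * g (x + y) :=
    measurable_norm.inv.ennreal_ofReal.mul hgx
  set S : Set (ℝ × E) := {p | 0 < p.1 ∧ p.1 ≤ 1 ∧ ‖p.2‖ ≤ p.1 * D} with hS
  have hSm : MeasurableSet S :=
    (measurableSet_lt measurable_const measurable_fst).inter
      ((measurableSet_le measurable_fst measurable_const).inter
        (measurableSet_le measurable_snd.norm (measurable_fst.mul_const D)))
  set Φ : ℝ × E → ENNReal :=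
    S.indicator fun p => ENNReal.ofReal ((p.1 ^ 2)⁻¹) * g (x + p.2) with hΦ
  have hΦm : Measurable Φ := by
    refine Measurable.indicator (Measurable.mul ?_ (hgx.comp measurable_snd)) hSm
    exact ((measurable_fst.pow_const 2).inv).ennreal_ofReal
  have step : ∀ s ∈ Set.Ioc (0 : ℝ) 1,
      ∫⁻ w in Metric.closedBall (0 : E) D, g (x + s • w) ∂μ = ∫⁻ y, Φ (s, y) ∂μ := by
    intro s hs
    have h1 : ∀ w, (Metric.closedBall (0 : E) D).indicator (fun w => g (x + s • w)) w =
        (Metric.closedBall (0 : E) (s * D)).indicator (fun y => g (x + y)) (s • w) := by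
      intro w
      have : w ∈ Metric.closedBall (0 : E) D ↔ s • w ∈ Metric.closedBall (0 : E) (s * D) := by
        simp only [mem_closedBall_zero_iff, norm_smul, Real.norm_of_nonneg hs.1.le]
        exact (mul_le_mul_iff_right₀ hs.1).symm
      by_cases hw : w ∈ Metric.closedBall (0 : E) D
      · rw [Set.indicator_of_mem hw, Set.indicator_of_mem (this.1 hw)]
      · rw [Set.indicator_of_notMem hw, Set.indicator_of_notMem (fun h => hw (this.2 h))]
    rw [← lintegral_indicator Metric.isClosed_closedBall.measurableSet, lintegral_congr h1,
      lintegral_comp_smul_addHaar μ (hgx.indicator Metric.isClosed_closedBall.measurableSet) hs.1,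
      hdim, ← lintegral_const_mul _ (hgx.indicator Metric.isClosed_closedBall.measurableSet)]
    refine lintegral_congr fun y => ?_
    by_cases hy : ‖y‖ ≤ s * D
    · rw [Set.indicator_of_mem (mem_closedBall_zero_iff.2 hy), hΦ,
        Set.indicator_of_mem (show (s, y) ∈ S from ⟨hs.1, hs.2, hy⟩)]
    · rw [Set.indicator_of_notMem (fun h => hy (mem_closedBall_zero_iff.1 h)), hΦ,
        Set.indicator_of_notMem (fun h : (s, y) ∈ S => hy h.2.2), mul_zero]
  rw [setLIntegral_congr_fun measurableSet_Ioc step,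
    lintegral_lintegral_swap (f := fun s y => Φ (s, y)) hΦm.aemeasurable,
    ← lintegral_const_mul _ hkm,
    ← lintegral_indicator Metric.isClosed_closedBall.measurableSet]
  refine lintegral_mono_ae ?_
  filter_upwards [compl_mem_ae_iff.2 (measure_singleton (0 : E))] with y hy
  have hy0 : 0 < ‖y‖ := norm_pos_iff.2 hy
  by_cases hyD : ‖y‖ ≤ D
  · rw [Set.indicator_of_mem (mem_closedBall_zero_iff.2 hyD)]
    calc ∫⁻ s in Set.Ioc (0 : ℝ) 1, Φ (s, y)
        ≤ ∫⁻ s, (Set.Ici (‖y‖ / D)).indicator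
            (fun s => ENNReal.ofReal ((s ^ 2)⁻¹) * g (x + y)) s := by
          refine (setLIntegral_le_lintegral _ _).trans (lintegral_mono fun s => ?_)
          refine Set.indicator_le (s := S) (f := fun p => ENNReal.ofReal ((p.1 ^ 2)⁻¹) * g (x + p.2))
            (g := fun p => (Set.Ici (‖p.2‖ / D)).indicator
              (fun s => ENNReal.ofReal ((s ^ 2)⁻¹) * g (x + p.2)) p.1) (fun p hp => ?_) (s, y)
          rw [Set.indicator_of_mem]
          exact (div_le_iff₀ hD).2 hp.2.2
      _ = (∫⁻ s in Set.Ici (‖y‖ / D), ENNReal.ofReal ((s ^ 2)⁻¹)) * g (x + y) := by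
          rw [lintegral_indicator measurableSet_Ici, lintegral_mul_const]
          exact ((measurable_id.pow_const 2).inv).ennreal_ofReal
      _ ≤ ENNReal.ofReal (‖y‖ / D)⁻¹ * g (x + y) := by
          gcongr
          exact setLIntegral_inv_sq_le (by positivity)
      _ = _ := by
          rw [← mul_assoc, ← ENNReal.ofReal_mul hD.le, inv_div, div_eq_mul_inv]
  · have : ∀ s, Φ (s, y) = 0 := fun s => Set.indicator_of_notMem (fun h : (s, y) ∈ S => hyD
      (h.2.2.trans (mul_le_of_le_one_left hD.le h.2.1))) _
    simp [this]

end Riesz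

section Young

lemma sq_lintegral_mul_le {α : Type*} [MeasurableSpace α] {μ : Measure α} {f g : α → ENNReal}
    (hf : AEMeasurable f μ) (hg : AEMeasurable g μ) :
    (∫⁻ a, f a * g a ∂μ) ^ 2 ≤ (∫⁻ a, f a ^ 2 ∂μ) * ∫⁻ a, g a ^ 2 ∂μ := by
  have h := ENNReal.lintegral_mul_le_Lp_mul_Lq μ Real.HolderConjugate.two_two hf hg
  simp only [ENNReal.rpow_two, Pi.mul_apply] at h
  calc (∫⁻ a, f a * g a ∂μ) ^ 2 ≤
      ((∫⁻ a, f a ^ 2 ∂μ) ^ (1 / 2 : ℝ) * (∫⁻ a, g a ^ 2 ∂μ) ^ (1 / 2 : ℝ)) ^ 2 := by gcongr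
    _ = _ := by
      rw [mul_pow, ← ENNReal.rpow_two, ← ENNReal.rpow_two, ← ENNReal.rpow_mul, ← ENNReal.rpow_mul]
      norm_num

lemma pow_four_lintegral_mul_le {α : Type*} [MeasurableSpace α] {μ : Measure α}
    {k g : α → ENNReal} (hk : AEMeasurable k μ) (hg : AEMeasurable g μ) :
    (∫⁻ a, k a * g a ∂μ) ^ 4 ≤
      (∫⁻ a, k a ^ (4 / 3 : ℝ) ∂μ) ^ 2 * (∫⁻ a, k a ^ (4 / 3 : ℝ) * g a ^ 2 ∂μ) *
        ∫⁻ a, g a ^ 2 ∂μ := by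
  have h1 : (∫⁻ a, k a * g a ∂μ) ^ 2 ≤
      (∫⁻ a, k a ^ (4 / 3 : ℝ) ∂μ) * ∫⁻ a, k a ^ (2 / 3 : ℝ) * g a ^ 2 ∂μ := by
    calc (∫⁻ a, k a * g a ∂μ) ^ 2
        = (∫⁻ a, k a ^ (2 / 3 : ℝ) * (k a ^ (1 / 3 : ℝ) * g a) ∂μ) ^ 2 := by
          congr 2
          ext a
          rw [← mul_assoc, ← ENNReal.rpow_add_of_nonneg _ _ (by norm_num) (by norm_num)]
          norm_num
      _ ≤ _ := sq_lintegral_mul_le (hk.pow_const _) ((hk.pow_const _).mul hg)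
      _ = _ := by
          congr 1
          · refine lintegral_congr fun a => ?_
            rw [← ENNReal.rpow_two, ← ENNReal.rpow_mul]
            norm_num
          · refine lintegral_congr fun a => ?_
            rw [mul_pow, ← ENNReal.rpow_two, ← ENNReal.rpow_mul]
            norm_num
  have h2 : (∫⁻ a, k a ^ (2 / 3 : ℝ) * g a ^ 2 ∂μ) ^ 2 ≤
      (∫⁻ a, k a ^ (4 / 3 : ℝ) * g a ^ 2 ∂μ) * ∫⁻ a, g a ^ 2 ∂μ := by
    calc (∫⁻ a, k a ^ (2 / 3 : ℝ) * g a ^ 2 ∂μ) ^ 2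
        = (∫⁻ a, (k a ^ (2 / 3 : ℝ) * g a) * g a ∂μ) ^ 2 := by
          congr 2
          ext a
          ring
      _ ≤ _ := sq_lintegral_mul_le ((hk.pow_const _).mul hg) hg
      _ = _ := by
          congr 1
          refine lintegral_congr fun a => ?_
          rw [mul_pow, ← ENNReal.rpow_two, ← ENNReal.rpow_mul]
          norm_num
  calc (∫⁻ a, k a * g a ∂μ) ^ 4 = ((∫⁻ a, k a * g a ∂μ) ^ 2) ^ 2 := by ring
    _ ≤ ((∫⁻ a, k a ^ (4 / 3 : ℝ) ∂μ) * ∫⁻ a, k a ^ (2 / 3 : ℝ) * g a ^ 2 ∂μ) ^ 2 := by gcongr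
    _ = (∫⁻ a, k a ^ (4 / 3 : ℝ) ∂μ) ^ 2 * (∫⁻ a, k a ^ (2 / 3 : ℝ) * g a ^ 2 ∂μ) ^ 2 := by ring
    _ ≤ (∫⁻ a, k a ^ (4 / 3 : ℝ) ∂μ) ^ 2 *
        ((∫⁻ a, k a ^ (4 / 3 : ℝ) * g a ^ 2 ∂μ) * ∫⁻ a, g a ^ 2 ∂μ) := by gcongr
    _ = _ := by ring

variable {E : Type*} [AddCommGroup E] [MeasurableSpace E] [MeasurableAdd₂ E]

lemma lintegral_pow_four_correlation_le {μ : Measure E} [SFinite μ] [μ.IsAddLeftInvariant]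
    {k g : E → ENNReal} (hk : Measurable k) (hg : Measurable g) :
    ∫⁻ x, (∫⁻ y, k y * g (x + y) ∂μ) ^ 4 ∂μ ≤
      (∫⁻ y, k y ^ (4 / 3 : ℝ) ∂μ) ^ 3 * (∫⁻ y, g y ^ 2 ∂μ) ^ 2 := by
  set κ := ∫⁻ y, k y ^ (4 / 3 : ℝ) ∂μ
  set G := ∫⁻ y, g y ^ 2 ∂μ with hG
  have hinv : ∀ x, ∫⁻ y, g (x + y) ^ 2 ∂μ = G := fun x =>
    lintegral_add_left_eq_self (fun y => g y ^ 2) x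
  have hinv' : ∀ y, ∫⁻ x, g (x + y) ^ 2 ∂μ = G := fun y => by
    simp_rw [add_comm _ y]
    exact hinv y
  have hm : Measurable fun p : E × E => k p.2 ^ (4 / 3 : ℝ) * g (p.1 + p.2) ^ 2 :=
    ((hk.comp measurable_snd).pow_const _).mul
      ((hg.comp (measurable_fst.add measurable_snd)).pow_const 2)
  calc ∫⁻ x, (∫⁻ y, k y * g (x + y) ∂μ) ^ 4 ∂μ
      ≤ ∫⁻ x, κ ^ 2 * (∫⁻ y, k y ^ (4 / 3 : ℝ) * g (x + y) ^ 2 ∂μ) * G ∂μ := by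
        refine lintegral_mono fun x => ?_
        have := pow_four_lintegral_mul_le (μ := μ) hk.aemeasurable
          (hg.comp (measurable_const_add x)).aemeasurable
        simp only [Function.comp_apply, hinv] at this
        exact this
    _ = κ ^ 2 * (∫⁻ x, ∫⁻ y, k y ^ (4 / 3 : ℝ) * g (x + y) ^ 2 ∂μ ∂μ) * G := by
        rw [lintegral_mul_const _ (hm.lintegral_prod_right'.const_mul _),
          lintegral_const_mul _ hm.lintegral_prod_right']
    _ = κ ^ 2 * (κ * G) * G := by
        rw [lintegral_lintegral_swap hm.aemeasurable]
        congr 2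
        rw [← lintegral_mul_const _ (hk.pow_const _)]
        refine lintegral_congr fun y => ?_
        rw [← hinv' y]
        exact lintegral_const_mul _ ((hg.comp (measurable_add_const y)).pow_const 2)
    _ = _ := by ring

end Young

section Kernel

variable {E : Type*} [NormedAddCommGroup E]

/-- The kernel `‖y‖⁻¹` restricted to the norms in `s`. -/
noncomputable def truncatedRieszKernel (s : Set ℝ) (y : E) : ENNReal :=
  ENNReal.ofReal (s.indicator (fun t => t⁻¹) ‖y‖)

lemma indicator_closedBall_inv_norm_le {η D : ℝ} (y : E) :
    (Metric.closedBall (0 : E) D).indicator (fun y => ENNReal.ofReal ‖y‖⁻¹) y ≤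
      truncatedRieszKernel (Set.Ioo 0 η) y + truncatedRieszKernel (Set.Icc η D) y := by
  refine Set.indicator_apply_le' (fun hy => ?_) fun _ => zero_le
  rw [mem_closedBall_zero_iff] at hy
  rcases (norm_nonneg y).eq_or_lt with h0 | h0
  · rw [← h0]
    simp
  rcases lt_or_ge ‖y‖ η with h | h
  · simp only [truncatedRieszKernel, Set.indicator_of_mem (show ‖y‖ ∈ Set.Ioo 0 η from ⟨h0, h⟩)]
    exact le_add_of_nonneg_right zero_le
  · simp only [truncatedRieszKernel, Set.indicator_of_mem (show ‖y‖ ∈ Set.Icc η D from ⟨h, hy⟩)]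
    exact le_add_of_nonneg_left zero_le

variable [MeasurableSpace E] [BorelSpace E]

lemma measurable_truncatedRieszKernel {s : Set ℝ} (hs : MeasurableSet s) :
    Measurable (truncatedRieszKernel s : E → ENNReal) :=
  ((measurable_inv.indicator hs).comp measurable_norm).ennreal_ofReal

variable [NormedSpace ℝ E] [FiniteDimensional ℝ E] [Nontrivial E]

lemma lintegral_ofReal_fun_norm_addHaar (μ : Measure E) [μ.IsAddHaarMeasure]
    (hdim : Module.finrank ℝ E = 2) {f : ℝ → ℝ} (hf : ∀ t, 0 ≤ f t)
    (hfi : IntegrableOn (fun t => t * f t) (Set.Ioi 0)) :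
    ∫⁻ x, ENNReal.ofReal (f ‖x‖) ∂μ =
      ENNReal.ofReal (2 * μ.real (Metric.ball 0 1) * ∫ t in Set.Ioi 0, t * f t) := by
  have h : Integrable (fun x : E => f ‖x‖) μ := by
    rw [integrable_fun_norm_addHaar μ (f := f), hdim]
    simpa using hfi
  rw [← ofReal_integral_eq_lintegral_ofReal h (.of_forall fun x => hf _),
    integral_fun_norm_addHaar μ f, hdim]
  congr 1
  simp [mul_assoc]

lemma lintegral_truncatedRieszKernel_near (μ : Measure E) [μ.IsAddHaarMeasure]
    (hdim : Module.finrank ℝ E = 2) {η : ℝ} (hη : 0 < η) :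
    ∫⁻ y, truncatedRieszKernel (Set.Ioo 0 η) y ^ (4 / 3 : ℝ) ∂μ =
      ENNReal.ofReal (3 * μ.real (Metric.ball 0 1) * η ^ (2 / 3 : ℝ)) := by
  set f : ℝ → ℝ := (Set.Ioo 0 η).indicator fun t => (t⁻¹) ^ (4 / 3 : ℝ)
  have hf : ∀ t, 0 ≤ f t := fun t => Set.indicator_nonneg
    (fun s hs => Real.rpow_nonneg (inv_nonneg.2 hs.1.le) _) t
  have hK : ∀ y : E, truncatedRieszKernel (Set.Ioo 0 η) y ^ (4 / 3 : ℝ) =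
      ENNReal.ofReal (f ‖y‖) := by
    intro y
    by_cases hy : ‖y‖ ∈ Set.Ioo 0 η
    · simp only [truncatedRieszKernel, f, Set.indicator_of_mem hy]
      exact ENNReal.ofReal_rpow_of_nonneg (by positivity) (by norm_num)
    · simp [truncatedRieszKernel, f, Set.indicator_of_notMem hy]
  have hfun : (fun t => t * f t) = (Set.Ioo 0 η).indicator fun t => t ^ (-(1 / 3) : ℝ) := by
    ext t
    by_cases ht : t ∈ Set.Ioo 0 η
    · simp only [f, Set.indicator_of_mem ht]
      rw [Real.inv_rpow ht.1.le, ← Real.rpow_neg ht.1.le]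
      nth_rw 1 [← Real.rpow_one t]
      rw [← Real.rpow_add ht.1]
      norm_num
    · simp [f, Set.indicator_of_notMem ht]
  have hsub : Set.Ioi (0 : ℝ) ∩ Set.Ioo 0 η = Set.Ioo 0 η :=
    Set.inter_eq_right.2 fun t ht => ht.1
  have hfi : IntegrableOn (fun t : ℝ => t ^ (-(1 / 3) : ℝ)) (Set.Ioo 0 η) := by
    rw [← intervalIntegrable_iff_integrableOn_Ioo_of_le hη.le]
    exact intervalIntegral.intervalIntegrable_rpow' (by norm_num)
  rw [lintegral_congr hK, lintegral_ofReal_fun_norm_addHaar μ hdim hf, hfun,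
    setIntegral_indicator measurableSet_Ioo, hsub, ← integral_Ioc_eq_integral_Ioo,
    ← intervalIntegral.integral_of_le hη.le, integral_rpow (Or.inl (by norm_num))]
  · congr 1
    norm_num
    ring
  · rw [hfun]
    exact (hfi.integrable_indicator measurableSet_Ioo).integrableOn

lemma lintegral_truncatedRieszKernel_far (μ : Measure E) [μ.IsAddHaarMeasure]
    (hdim : Module.finrank ℝ E = 2) {η D : ℝ} (hη : 0 < η) (hD : η ≤ D) :
    ∫⁻ y, truncatedRieszKernel (Set.Icc η D) y ^ 2 ∂μ =
      ENNReal.ofReal (2 * μ.real (Metric.ball 0 1) * Real.log (D / η)) := by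
  set f : ℝ → ℝ := (Set.Icc η D).indicator fun t => (t⁻¹) ^ 2
  have hf : ∀ t, 0 ≤ f t := fun t => Set.indicator_nonneg (fun s _ => by positivity) t
  have hK : ∀ y : E, truncatedRieszKernel (Set.Icc η D) y ^ 2 = ENNReal.ofReal (f ‖y‖) := by
    intro y
    by_cases hy : ‖y‖ ∈ Set.Icc η D
    · simp only [truncatedRieszKernel, f, Set.indicator_of_mem hy]
      exact (ENNReal.ofReal_pow (by positivity) 2).symm
    · simp [truncatedRieszKernel, f, Set.indicator_of_notMem hy]
  have hfun : (fun t => t * f t) = (Set.Icc η D).indicator fun t => t⁻¹ := by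
    ext t
    by_cases ht : t ∈ Set.Icc η D
    · have : t ≠ 0 := (hη.trans_le ht.1).ne'
      simp only [f, Set.indicator_of_mem ht]
      field_simp
    · simp [f, Set.indicator_of_notMem ht]
  have hsub : Set.Ioi (0 : ℝ) ∩ Set.Icc η D = Set.Icc η D :=
    Set.inter_eq_right.2 fun t ht => hη.trans_le ht.1
  have hfi : IntegrableOn (fun t : ℝ => t⁻¹) (Set.Icc η D) :=
    ContinuousOn.integrableOn_Icc fun t ht =>
      (continuousAt_inv₀ (hη.trans_le ht.1).ne').continuousWithinAt
  rw [lintegral_congr hK, lintegral_ofReal_fun_norm_addHaar μ hdim hf, hfun,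
    setIntegral_indicator measurableSet_Icc, hsub, integral_Icc_eq_integral_Ioc,
    ← intervalIntegral.integral_of_le hD, integral_inv_of_pos hη (hη.trans_le hD)]
  · rw [hfun]
    exact (hfi.integrable_indicator measurableSet_Icc).integrableOn

end Kernel

section Representation

variable {E F : Type*} [NormedAddCommGroup E] [NormedSpace ℝ E] [MeasurableSpace E] [BorelSpace E]
  [FiniteDimensional ℝ E] [Nontrivial E] [NormedAddCommGroup F] [NormedSpace ℝ F]
  [CompleteSpace F]

lemma measure_ball_mul_enorm_le_riesz (μ : Measure E) [μ.IsAddHaarMeasure]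
    (hdim : Module.finrank ℝ E = 2) {Ω : Set E} (hΩ : MeasurableSet Ω) {u : E → F}
    (hu : Differentiable ℝ u) {D : ℝ} (hD : 0 < D) {x e : E} {δ : ℝ}
    (hcone : ∀ w ∈ Metric.ball e δ, ∀ s ∈ Set.Icc (0 : ℝ) 1, x + s • w ∈ Ω)
    (hsub : Metric.ball e δ ⊆ Metric.closedBall 0 D) :
    μ (Metric.ball 0 δ) * ‖u x‖ₑ ≤ ∫⁻ y in Ω, ‖u y‖ₑ ∂μ + ENNReal.ofReal (D ^ 2) *
      ∫⁻ y in Metric.closedBall (0 : E) D, ENNReal.ofReal ‖y‖⁻¹ *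
        Ω.indicator (fun z => ‖fderiv ℝ u z‖ₑ) (x + y) ∂μ := by
  set g : E → ENNReal := Ω.indicator fun z => ‖fderiv ℝ u z‖ₑ
  have hg : Measurable g := (measurable_fderiv ℝ u).enorm.indicator hΩ
  have hum : Measurable fun y => ‖u y‖ₑ := hu.continuous.enorm.measurable
  have hball : MeasurableSet (Metric.ball e δ) := Metric.isOpen_ball.measurableSet
  have hgm : Measurable fun p : E × ℝ => g (x + p.2 • p.1) :=
    hg.comp ((measurable_snd.smul measurable_fst).const_add x)
  have humx : Measurable fun w => Ω.indicator (fun y => ‖u y‖ₑ) (x + w) :=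
    (hum.indicator hΩ).comp (measurable_const_add x)
  have hgs : Measurable fun w => ∫⁻ s in Set.Ioc (0 : ℝ) 1, g (x + s • w) :=
    hgm.lintegral_prod_right'
  have hpt : ∀ w ∈ Metric.ball e δ, ‖u x‖ₑ ≤ Ω.indicator (fun y => ‖u y‖ₑ) (x + w) +
      ENNReal.ofReal D * ∫⁻ s in Set.Ioc (0 : ℝ) 1, g (x + s • w) := by
    intro w hw
    have hwD : ‖w‖ₑ ≤ ENNReal.ofReal D := by
      rw [← ofReal_norm]
      exact ENNReal.ofReal_le_ofReal (mem_closedBall_zero_iff.1 (hsub hw))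
    have hmem : x + w ∈ Ω := by simpa using hcone w hw 1 (by simp)
    refine (enorm_le_enorm_add_lintegral_segment hu x w).trans ?_
    rw [Set.indicator_of_mem hmem]
    refine add_le_add le_rfl ?_
    rw [lintegral_mul_const' _ _ enorm_ne_top, mul_comm]
    refine mul_le_mul' hwD ?_
    refine setLIntegral_mono' measurableSet_Ioc fun s hs => ?_
    simp only [g, Set.indicator_of_mem (hcone w hw s ⟨hs.1.le, hs.2⟩)]
    exact le_rfl
  calc μ (Metric.ball 0 δ) * ‖u x‖ₑ = ∫⁻ _ in Metric.ball e δ, ‖u x‖ₑ ∂μ := by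
        rw [setLIntegral_const, Measure.addHaar_ball_center μ e δ, mul_comm]
    _ ≤ ∫⁻ w in Metric.ball e δ, (Ω.indicator (fun y => ‖u y‖ₑ) (x + w) +
          ENNReal.ofReal D * ∫⁻ s in Set.Ioc (0 : ℝ) 1, g (x + s • w)) ∂μ :=
        setLIntegral_mono' hball hpt
    _ = ∫⁻ w in Metric.ball e δ, Ω.indicator (fun y => ‖u y‖ₑ) (x + w) ∂μ +
          ENNReal.ofReal D * ∫⁻ w in Metric.ball e δ,
            ∫⁻ s in Set.Ioc (0 : ℝ) 1, g (x + s • w) ∂volume ∂μ := by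
        rw [lintegral_add_left humx, lintegral_const_mul _ hgs]
    _ ≤ ∫⁻ y in Ω, ‖u y‖ₑ ∂μ + ENNReal.ofReal D * (ENNReal.ofReal D *
          ∫⁻ y in Metric.closedBall (0 : E) D, ENNReal.ofReal ‖y‖⁻¹ * g (x + y) ∂μ) := by
        refine add_le_add ?_ (mul_le_mul' le_rfl ?_)
        · refine (setLIntegral_le_lintegral _ _).trans_eq ?_
          rw [lintegral_add_left_eq_self (fun y => Ω.indicator (fun y => ‖u y‖ₑ) y) x,
            lintegral_indicator hΩ]
        · rw [lintegral_lintegral_swap (f := fun w s => g (x + s • w)) hgm.aemeasurable]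
          refine (lintegral_mono fun s => ?_).trans (lintegral_cone_le μ hdim hg hD x)
          exact lintegral_mono_set hsub
    _ = _ := by rw [← mul_assoc, ← ENNReal.ofReal_mul hD.le, sq]

end Representation

section Decomposition

lemma ENNReal.add_sq_le_four_mul (a b : ENNReal) : (a + b) ^ 2 ≤ 4 * (a ^ 2 + b ^ 2) := by
  rcases le_total a b with h | h
  · calc (a + b) ^ 2 ≤ (b + b) ^ 2 := by gcongr
      _ = 4 * b ^ 2 := by ring
      _ ≤ _ := by gcongr; exact le_add_of_nonneg_left zero_le
  · calc (a + b) ^ 2 ≤ (a + a) ^ 2 := by gcongr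
      _ = 4 * a ^ 2 := by ring
      _ ≤ _ := by gcongr; exact le_add_of_nonneg_right zero_le

variable {E F : Type*} [NormedAddCommGroup E] [NormedSpace ℝ E] [MeasurableSpace E] [BorelSpace E]
  [FiniteDimensional ℝ E] [Nontrivial E] [NormedAddCommGroup F] [NormedSpace ℝ F]
  [CompleteSpace F]

/-- On a bounded planar domain with a uniform interior cone, `u` is dominated by a constant of size
`(log η⁻¹)^{1/2} ‖u‖_{H¹}` and a function of size `η^{1/2} ‖u‖_{H¹}` in `L⁴`. -/
lemma exists_enorm_le_const_add (μ : Measure E) [μ.IsAddHaarMeasure]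
    (hdim : Module.finrank ℝ E = 2) {Ω : Set E} (hΩ : MeasurableSet Ω)
    (hbdd : Bornology.IsBounded Ω) {δ : ℝ} (hδ : 0 < δ)
    (hcone : ∀ x ∈ Ω, ∃ e : E, ∀ w ∈ Metric.ball e δ, ∀ s ∈ Set.Icc (0 : ℝ) 1, x + s • w ∈ Ω) :
    ∃ C : ℝ, 0 < C ∧ ∀ u : E → F, Differentiable ℝ u → ∀ η : ℝ, 0 < η → η ≤ 1 / 2 →
      ∃ (A : ENNReal) (b : E → ENNReal), Measurable b ∧ (∀ x ∈ Ω, ‖u x‖ₑ ≤ A + b x) ∧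
        A ^ 2 ≤ ENNReal.ofReal (C * Real.log η⁻¹) *
          ∫⁻ y in Ω, (‖u y‖ₑ ^ 2 + ‖fderiv ℝ u y‖ₑ ^ 2) ∂μ ∧
        ∫⁻ x, b x ^ 4 ∂μ ≤ ENNReal.ofReal (C * η ^ 2) *
          (∫⁻ y in Ω, (‖u y‖ₑ ^ 2 + ‖fderiv ℝ u y‖ₑ ^ 2) ∂μ) ^ 2 := by
  obtain ⟨D, hD1, hDdiam⟩ : ∃ D : ℝ, 1 ≤ D ∧ Metric.diam Ω ≤ D :=
    ⟨max 1 (Metric.diam Ω), le_max_left _ _, le_max_right _ _⟩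
  have hD : 0 < D := one_pos.trans_le hD1
  set v := μ.real (Metric.ball (0 : E) δ) with hv
  have hvpos : 0 < v :=
    ENNReal.toReal_pos (Metric.measure_ball_pos μ 0 hδ).ne' measure_ball_lt_top.ne
  have hvE : μ (Metric.ball (0 : E) δ) = ENNReal.ofReal v :=
    (ENNReal.ofReal_toReal measure_ball_lt_top.ne).symm
  set m := μ.real Ω with hm
  have hmE : μ Ω = ENNReal.ofReal m := (ENNReal.ofReal_toReal hbdd.measure_lt_top.ne).symm
  have hm0 : 0 ≤ m := measureReal_nonneg
  set ω := μ.real (Metric.ball (0 : E) 1) with hω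
  have hω0 : 0 ≤ ω := measureReal_nonneg
  have hlog2 : 0 < Real.log 2 := Real.log_pos one_lt_two
  have hlogD : 0 ≤ Real.log D := Real.log_nonneg hD1
  set C₁ := (v⁻¹) ^ 2 * 4 * (m / Real.log 2 + D ^ 4 * (2 * ω * (Real.log D / Real.log 2 + 1)))
    with hC₁
  set C₂ := (v⁻¹ * D ^ 2) ^ 4 * (27 * ω ^ 3) with hC₂
  have hC₁0 : 0 ≤ C₁ := by positivity
  have hC₂0 : 0 ≤ C₂ := by positivity
  refine ⟨C₁ + C₂ + 1, by positivity, fun u hu η hη hη2 => ?_⟩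
  have hum : Measurable fun y => ‖u y‖ₑ := hu.continuous.enorm.measurable
  have hL : Real.log 2 ≤ Real.log η⁻¹ := by
    refine Real.log_le_log two_pos ?_
    rw [le_inv_comm₀ two_pos hη]
    simpa using hη2
  set g : E → ENNReal := Ω.indicator fun z => ‖fderiv ℝ u z‖ₑ with hgdef
  have hg : Measurable g := (measurable_fderiv ℝ u).enorm.indicator hΩ
  set H := ∫⁻ y in Ω, (‖u y‖ₑ ^ 2 + ‖fderiv ℝ u y‖ₑ ^ 2) ∂μ with hH
  have hgH : ∫⁻ y, g y ^ 2 ∂μ ≤ H := by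
    have : ∀ y, g y ^ 2 = Ω.indicator (fun z => ‖fderiv ℝ u z‖ₑ ^ 2) y := fun y => by
      by_cases hy : y ∈ Ω <;> simp [g, hy]
    rw [lintegral_congr this, lintegral_indicator hΩ]
    exact lintegral_mono fun y => le_add_self
  have huH : (∫⁻ y in Ω, ‖u y‖ₑ ∂μ) ^ 2 ≤ ENNReal.ofReal m * H := by
    have h := sq_lintegral_mul_le (μ := μ.restrict Ω) (f := fun _ => 1)
      aemeasurable_const hum.aemeasurable
    simp only [one_mul, one_pow, lintegral_const, Measure.restrict_apply_univ, hmE] at h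
    exact h.trans (by gcongr; exact lintegral_mono fun y => le_self_add)
  set K₁ : E → ENNReal := truncatedRieszKernel (Set.Ioo 0 η)
  set K₂ : E → ENNReal := truncatedRieszKernel (Set.Icc η D)
  have hK₁ : Measurable K₁ := measurable_truncatedRieszKernel measurableSet_Ioo
  have hK₂ : Measurable K₂ := measurable_truncatedRieszKernel measurableSet_Icc
  have hfar : ∀ x, ∫⁻ y, K₂ y * g (x + y) ∂μ ≤
      (ENNReal.ofReal (2 * ω * Real.log (D / η)) * H) ^ (1 / 2 : ℝ) := by
    intro x
    have h := sq_lintegral_mul_le (μ := μ) hK₂.aemeasurable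
      (hg.comp (measurable_const_add x)).aemeasurable
    simp only [Function.comp_apply] at h
    rw [lintegral_truncatedRieszKernel_far μ hdim hη (by linarith),
      lintegral_add_left_eq_self (fun y => g y ^ 2) x] at h
    calc ∫⁻ y, K₂ y * g (x + y) ∂μ = ((∫⁻ y, K₂ y * g (x + y) ∂μ) ^ 2) ^ (1 / 2 : ℝ) := by
          rw [← ENNReal.rpow_two, ← ENNReal.rpow_mul]
          norm_num
      _ ≤ _ := ENNReal.rpow_le_rpow (h.trans (mul_le_mul' le_rfl hgH)) (by norm_num)
  set A := (ENNReal.ofReal v)⁻¹ * (∫⁻ y in Ω, ‖u y‖ₑ ∂μ + ENNReal.ofReal (D ^ 2) *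
    (ENNReal.ofReal (2 * ω * Real.log (D / η)) * H) ^ (1 / 2 : ℝ)) with hA
  set b : E → ENNReal := fun x => ENNReal.ofReal (v⁻¹ * D ^ 2) * ∫⁻ y, K₁ y * g (x + y) ∂μ with hb
  have hkm : Measurable fun p : E × E => K₁ p.2 * g (p.1 + p.2) :=
    (hK₁.comp measurable_snd).mul (hg.comp (measurable_fst.add measurable_snd))
  refine ⟨A, b, hkm.lintegral_prod_right'.const_mul _, fun x hx => ?_, ?_, ?_⟩
  · obtain ⟨e, he⟩ := hcone x hx
    have hsub : Metric.ball e δ ⊆ Metric.closedBall 0 D := fun w hw => by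
      have h1 : x + w ∈ Ω := by simpa using he w hw 1 (by simp)
      have h2 := Metric.dist_le_diam_of_mem hbdd h1 hx
      rw [mem_closedBall_zero_iff]
      simp only [dist_eq_norm, add_sub_cancel_left] at h2
      exact h2.trans hDdiam
    have key := measure_ball_mul_enorm_le_riesz μ hdim hΩ hu hD he hsub
    have hsplit : ∫⁻ y in Metric.closedBall (0 : E) D, ENNReal.ofReal ‖y‖⁻¹ * g (x + y) ∂μ ≤
        ∫⁻ y, K₁ y * g (x + y) ∂μ + ∫⁻ y, K₂ y * g (x + y) ∂μ := by
      have hk1 : Measurable fun y => K₁ y * g (x + y) :=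
        hK₁.mul (hg.comp (measurable_const_add x))
      rw [← lintegral_add_left hk1,
        ← lintegral_indicator Metric.isClosed_closedBall.measurableSet]
      refine lintegral_mono fun y => ?_
      simp only
      rw [← add_mul]
      refine le_trans (le_of_eq ?_) (mul_le_mul'
        (indicator_closedBall_inv_norm_le (η := η) (D := D) y) (le_refl (g (x + y))))
      by_cases hy : y ∈ Metric.closedBall (0 : E) D
      · simp only [Set.indicator_of_mem hy]
      · simp only [Set.indicator_of_notMem hy, zero_mul]
    rw [hvE] at key
    have hv0 : ENNReal.ofReal v ≠ 0 := by simpa using hvpos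
    calc ‖u x‖ₑ = (ENNReal.ofReal v)⁻¹ * (ENNReal.ofReal v * ‖u x‖ₑ) := by
          rw [← mul_assoc, ENNReal.inv_mul_cancel hv0 ENNReal.ofReal_ne_top, one_mul]
      _ ≤ (ENNReal.ofReal v)⁻¹ * (∫⁻ y in Ω, ‖u y‖ₑ ∂μ + ENNReal.ofReal (D ^ 2) *
            (∫⁻ y, K₁ y * g (x + y) ∂μ +
              (ENNReal.ofReal (2 * ω * Real.log (D / η)) * H) ^ (1 / 2 : ℝ))) := by
          gcongr
          refine key.trans ?_
          gcongr
          refine hsplit.trans ?_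
          gcongr
          exact hfar x
      _ = A + b x := by
          simp only [hA, hb]
          rw [ENNReal.ofReal_mul (p := v⁻¹) (by positivity), ENNReal.ofReal_inv_of_pos hvpos]
          ring
  · have hreal : (v⁻¹) ^ 2 * (4 * (m + (D ^ 2) ^ 2 * (2 * ω * Real.log (D / η)))) ≤
        (C₁ + C₂ + 1) * Real.log η⁻¹ := by
      have h1 : 1 ≤ Real.log η⁻¹ / Real.log 2 := (one_le_div hlog2).2 hL
      have h2 : Real.log (D / η) ≤ (Real.log D / Real.log 2 + 1) * Real.log η⁻¹ := by
        rw [div_eq_mul_inv, Real.log_mul hD.ne' (inv_ne_zero hη.ne')]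
        have := mul_le_mul_of_nonneg_left h1 hlogD
        calc Real.log D + Real.log η⁻¹
            ≤ Real.log D * (Real.log η⁻¹ / Real.log 2) + Real.log η⁻¹ := by linarith
          _ = _ := by ring
      have h3 : m ≤ m / Real.log 2 * Real.log η⁻¹ := by
        calc m ≤ m * (Real.log η⁻¹ / Real.log 2) := le_mul_of_one_le_right hm0 h1
          _ = _ := by ring
      calc _ ≤ (v⁻¹) ^ 2 * (4 * (m / Real.log 2 * Real.log η⁻¹ + (D ^ 2) ^ 2 *
              (2 * ω * ((Real.log D / Real.log 2 + 1) * Real.log η⁻¹)))) := by gcongr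
        _ = C₁ * Real.log η⁻¹ := by rw [hC₁]; ring
        _ ≤ _ := by
            gcongr
            · exact hlog2.le.trans hL
            · linarith
    have hlogDη : 0 ≤ Real.log (D / η) :=
      Real.log_nonneg ((one_le_div hη).2 (by linarith))
    calc A ^ 2 = ENNReal.ofReal ((v⁻¹) ^ 2) * (∫⁻ y in Ω, ‖u y‖ₑ ∂μ + ENNReal.ofReal (D ^ 2) *
          (ENNReal.ofReal (2 * ω * Real.log (D / η)) * H) ^ (1 / 2 : ℝ)) ^ 2 := by
          rw [hA, mul_pow, ENNReal.ofReal_pow (p := v⁻¹) (by positivity),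
            ENNReal.ofReal_inv_of_pos hvpos]
      _ ≤ ENNReal.ofReal ((v⁻¹) ^ 2) * (4 * ((∫⁻ y in Ω, ‖u y‖ₑ ∂μ) ^ 2 +
          (ENNReal.ofReal (D ^ 2) *
            (ENNReal.ofReal (2 * ω * Real.log (D / η)) * H) ^ (1 / 2 : ℝ)) ^ 2)) := by
          gcongr
          exact ENNReal.add_sq_le_four_mul _ _
      _ ≤ ENNReal.ofReal ((v⁻¹) ^ 2) * (4 * (ENNReal.ofReal m * H +
          ENNReal.ofReal ((D ^ 2) ^ 2) * (ENNReal.ofReal (2 * ω * Real.log (D / η)) * H))) := by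
          gcongr
          rw [mul_pow, ENNReal.ofReal_pow (p := D ^ 2) (by positivity),
            ← ENNReal.rpow_two (_ ^ (1 / 2 : ℝ)), ← ENNReal.rpow_mul]
          norm_num
      _ = ENNReal.ofReal ((v⁻¹) ^ 2 * (4 * (m + (D ^ 2) ^ 2 * (2 * ω * Real.log (D / η))))) *
            H := by
          have hX : 0 ≤ 2 * ω * Real.log (D / η) := by positivity
          generalize 2 * ω * Real.log (D / η) = X at hX
          rw [ENNReal.ofReal_mul (p := (v⁻¹) ^ 2) (by positivity),
            ENNReal.ofReal_mul (p := 4) (by positivity), ENNReal.ofReal_add hm0 (by positivity),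
            ENNReal.ofReal_mul (p := (D ^ 2) ^ 2) (by positivity), ENNReal.ofReal_ofNat]
          ring
      _ ≤ _ := by gcongr
  · calc ∫⁻ x, b x ^ 4 ∂μ = ENNReal.ofReal (v⁻¹ * D ^ 2) ^ 4 *
          ∫⁻ x, (∫⁻ y, K₁ y * g (x + y) ∂μ) ^ 4 ∂μ := by
          rw [← lintegral_const_mul _ (hkm.lintegral_prod_right'.pow_const 4)]
          exact lintegral_congr fun x => mul_pow _ _ _
      _ ≤ ENNReal.ofReal (v⁻¹ * D ^ 2) ^ 4 *
          (ENNReal.ofReal (3 * ω * η ^ (2 / 3 : ℝ)) ^ 3 * H ^ 2) := by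
          gcongr
          refine (lintegral_pow_four_correlation_le hK₁ hg).trans ?_
          rw [lintegral_truncatedRieszKernel_near μ hdim hη]
          gcongr
      _ = ENNReal.ofReal (C₂ * η ^ 2) * H ^ 2 := by
          rw [← mul_assoc, ← ENNReal.ofReal_pow (by positivity),
            ← ENNReal.ofReal_pow (by positivity), ← ENNReal.ofReal_mul (by positivity),
            mul_pow _ (η ^ (2 / 3 : ℝ)), ← Real.rpow_natCast (η ^ (2 / 3 : ℝ)),
            ← Real.rpow_mul hη.le]
          congr 2
          rw [hC₂]
          norm_num
          ring
      _ ≤ _ := by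
          gcongr
          linarith

end Decomposition

lemma ENNReal.pow_four_le_of_le_add {a A b : ENNReal} (h : a ≤ A + b) :
    a ^ 4 ≤ 4 * A ^ 2 * a ^ 2 + 16 * b ^ 4 := by
  rcases le_total b A with hb | hb
  · calc a ^ 4 = a ^ 2 * a ^ 2 := by ring
      _ ≤ (A + A) ^ 2 * a ^ 2 := by gcongr; exact h.trans (by gcongr)
      _ = 4 * A ^ 2 * a ^ 2 := by ring
      _ ≤ _ := le_self_add
  · calc a ^ 4 ≤ (b + b) ^ 4 := by gcongr; exact h.trans (by gcongr)
      _ = 16 * b ^ 4 := by ring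
      _ ≤ _ := le_add_self

lemma lintegral_sq_mul_pow_four_le {α : Type*} [MeasurableSpace α] {μ : Measure α}
    {r a b : α → ENNReal} {R A : ENNReal} (hrm : Measurable r) (ham : Measurable a)
    (hb : Measurable b) (hr : ∀ᵐ x ∂μ, r x ≤ R) (ha : ∀ᵐ x ∂μ, a x ≤ A + b x) :
    ∫⁻ x, r x ^ 2 * a x ^ 4 ∂μ ≤
      4 * R * A ^ 2 * ∫⁻ x, r x * a x ^ 2 ∂μ + 16 * R ^ 2 * ∫⁻ x, b x ^ 4 ∂μ := by
  have hra : Measurable fun x => r x * a x ^ 2 := hrm.mul (ham.pow_const 2)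
  rw [← lintegral_const_mul _ hra, ← lintegral_const_mul _ (hb.pow_const 4),
    ← lintegral_add_right _ ((hb.pow_const 4).const_mul _)]
  refine lintegral_mono_ae ?_
  filter_upwards [hr, ha] with x hrx hax
  calc r x ^ 2 * a x ^ 4 ≤ r x ^ 2 * (4 * A ^ 2 * a x ^ 2 + 16 * b x ^ 4) := by
        gcongr
        exact ENNReal.pow_four_le_of_le_add hax
    _ = 4 * r x * A ^ 2 * (r x * a x ^ 2) + 16 * r x ^ 2 * b x ^ 4 := by ring
    _ ≤ _ := by gcongr

lemma interpolation_const_le {C ρs h V : ℝ} (hC : 0 ≤ C) (hρs : 0 ≤ ρs) (hh : 0 ≤ h)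
    (hV : 0 ≤ V) :
    4 * ρs * (C * Real.log (2 + h) * h) * V + 16 * ρs ^ 2 * (C * ((2 + h)⁻¹) ^ 2 * h ^ 2) ≤
      (4 * ρs * C + 16 * ρs ^ 2 * C / Real.log 2) *
        ((1 + √V) ^ 2 * h * Real.log (2 + h)) := by
  have hlog2 : 0 < Real.log 2 := Real.log_pos one_lt_two
  have hL : Real.log 2 ≤ Real.log (2 + h) := Real.log_le_log two_pos (by linarith)
  have hL0 : 0 ≤ Real.log (2 + h) := hlog2.le.trans hL
  have hVs : V ≤ (1 + √V) ^ 2 := by nlinarith [Real.sq_sqrt hV, Real.sqrt_nonneg V]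
  have h1s : 1 ≤ (1 + √V) ^ 2 := by nlinarith [Real.sqrt_nonneg V]
  have hη : ((2 + h)⁻¹) ^ 2 * h ^ 2 ≤ h := by
    rw [inv_pow, inv_mul_le_iff₀ (by positivity)]
    nlinarith [mul_nonneg hh hh, mul_nonneg hh (mul_nonneg hh hh)]
  have hlog : h ≤ h * Real.log (2 + h) / Real.log 2 := by
    rw [le_div_iff₀ hlog2]
    gcongr
  calc 4 * ρs * (C * Real.log (2 + h) * h) * V + 16 * ρs ^ 2 * (C * ((2 + h)⁻¹) ^ 2 * h ^ 2)
      = 4 * ρs * C * (V * h * Real.log (2 + h)) +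
          16 * ρs ^ 2 * C * (1 * (((2 + h)⁻¹) ^ 2 * h ^ 2)) := by ring
    _ ≤ 4 * ρs * C * ((1 + √V) ^ 2 * h * Real.log (2 + h)) +
          16 * ρs ^ 2 * C * ((1 + √V) ^ 2 * (h * Real.log (2 + h) / Real.log 2)) := by
        gcongr
        exact hη.trans hlog
    _ = _ := by ring

/-- Logarithmic interpolation inequality on a bounded `C¹` planar domain `Ω`:
there is `C = C(ρ∗, Ω)` such that for every measurable `0 ≤ ρ ≤ ρ∗` and every
`u ∈ H¹(Ω)` (here represented by a differentiable function with `u, ∇u ∈ L²(Ω)`),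
`‖√ρ u‖²_{L⁴(Ω)} ≤ C (1 + ‖√ρ u‖_{L²(Ω)}) ‖u‖_{H¹(Ω)} log^{1/2}(2 + ‖u‖²_{H¹(Ω)})`. -/
theorem stmt_13 (Ω : Set (EuclideanSpace ℝ (Fin 2)))
    (hopen : IsOpen Ω) (hbdd : Bornology.IsBounded Ω)
    (hC1bdry : ∃ f : EuclideanSpace ℝ (Fin 2) → ℝ, ContDiff ℝ 1 f ∧
      Ω = {x | f x < 0} ∧ ∀ x ∈ frontier Ω, fderiv ℝ f x ≠ 0)
    (ρs : ℝ) (hρs : 0 < ρs) :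
    ∃ C : ℝ, 0 < C ∧
      ∀ (ρ : EuclideanSpace ℝ (Fin 2) → ℝ)
        (u : EuclideanSpace ℝ (Fin 2) → EuclideanSpace ℝ (Fin 2)),
        Measurable ρ → (∀ x, 0 ≤ ρ x ∧ ρ x ≤ ρs) →
        Differentiable ℝ u →
        IntegrableOn (fun x => ‖u x‖ ^ 2) Ω →
        IntegrableOn (fun x => ‖fderiv ℝ u x‖ ^ 2) Ω →
        Real.sqrt (∫ x in Ω, ρ x ^ 2 * ‖u x‖ ^ 4) ≤
          C * (1 + Real.sqrt (∫ x in Ω, ρ x * ‖u x‖ ^ 2)) *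
            Real.sqrt (∫ x in Ω, (‖u x‖ ^ 2 + ‖fderiv ℝ u x‖ ^ 2)) *
            Real.sqrt
              (Real.log (2 + ∫ x in Ω, (‖u x‖ ^ 2 + ‖fderiv ℝ u x‖ ^ 2))) := by
  obtain ⟨f, hf, hΩf, hreg⟩ := hC1bdry
  obtain ⟨δ, hδ, hcone⟩ := exists_uniform_interior_cone hf hΩf hbdd.isCompact_closure hreg
  obtain ⟨C, hC, key⟩ := exists_enorm_le_const_add (F := EuclideanSpace ℝ (Fin 2)) volume
    (by simp) hopen.measurableSet hbdd hδ hcone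
  have hlog2 : 0 < Real.log 2 := Real.log_pos one_lt_two
  set M := 4 * ρs * C + 16 * ρs ^ 2 * C / Real.log 2 with hM
  have hMpos : 0 < M := by positivity
  refine ⟨√M, Real.sqrt_pos.2 hMpos, fun ρ u hρ hρb hu hu2 hdu2 => ?_⟩
  set h := ∫ x in Ω, (‖u x‖ ^ 2 + ‖fderiv ℝ u x‖ ^ 2) with hh
  set V := ∫ x in Ω, ρ x * ‖u x‖ ^ 2 with hV
  have hh0 : 0 ≤ h := integral_nonneg fun x => by positivity
  have hρu0 : ∀ x, 0 ≤ ρ x * ‖u x‖ ^ 2 := fun x => mul_nonneg (hρb x).1 (by positivity)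
  have hV0 : 0 ≤ V := integral_nonneg hρu0
  have henorm : ∀ {G : Type} [NormedAddCommGroup G] (y : G),
      ‖y‖ₑ ^ 2 = ENNReal.ofReal (‖y‖ ^ 2) := fun y => by
    rw [ENNReal.ofReal_pow (norm_nonneg y), ofReal_norm]
  have hH : ∫⁻ y in Ω, (‖u y‖ₑ ^ 2 + ‖fderiv ℝ u y‖ₑ ^ 2) = ENNReal.ofReal h := by
    have hfi : IntegrableOn (fun x => ‖u x‖ ^ 2 + ‖fderiv ℝ u x‖ ^ 2) Ω := hu2.add hdu2
    rw [hh, ofReal_integral_eq_lintegral_ofReal hfi (.of_forall fun x => by positivity)]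
    refine lintegral_congr fun x => ?_
    rw [henorm, henorm, ← ENNReal.ofReal_add (by positivity) (by positivity)]
  have hVint : IntegrableOn (fun x => ρ x * ‖u x‖ ^ 2) Ω := by
    refine (hu2.const_mul ρs).mono'
      (hρ.mul (hu.continuous.norm.pow 2).measurable).aestronglyMeasurable (.of_forall fun x => ?_)
    rw [Real.norm_of_nonneg (hρu0 x)]
    exact mul_le_mul_of_nonneg_right (hρb x).2 (by positivity)
  have hVE : ∫⁻ x in Ω, ENNReal.ofReal (ρ x) * ‖u x‖ₑ ^ 2 = ENNReal.ofReal V := by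
    rw [hV, ofReal_integral_eq_lintegral_ofReal hVint (.of_forall hρu0)]
    refine lintegral_congr fun x => ?_
    rw [henorm, ENNReal.ofReal_mul (hρb x).1]
  obtain ⟨A, b, hb, hub, hA, hb4⟩ := key u hu (2 + h)⁻¹ (by positivity) (by
    rw [one_div]
    exact inv_anti₀ two_pos (by linarith))
  rw [hH, inv_inv, ← ENNReal.ofReal_mul' hh0] at hA
  rw [hH, ← ENNReal.ofReal_pow hh0, ← ENNReal.ofReal_mul' (by positivity)] at hb4
  have hL0 : 0 ≤ Real.log (2 + h) := Real.log_nonneg (by linarith)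
  have hX := interpolation_const_le hC.le hρs.le hh0 hV0
  have hmain : ∫ x in Ω, ρ x ^ 2 * ‖u x‖ ^ 4 ≤
      4 * ρs * (C * Real.log (2 + h) * h) * V + 16 * ρs ^ 2 * (C * ((2 + h)⁻¹) ^ 2 * h ^ 2) := by
    have hm : Measurable fun x => ρ x ^ 2 * ‖u x‖ ^ 4 :=
      (hρ.pow_const 2).mul (hu.continuous.norm.pow 4).measurable
    rw [integral_eq_lintegral_of_nonneg_ae (.of_forall fun x => by positivity)
      hm.aestronglyMeasurable]
    refine ENNReal.toReal_le_of_le_ofReal (by positivity) ?_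
    calc ∫⁻ x in Ω, ENNReal.ofReal (ρ x ^ 2 * ‖u x‖ ^ 4)
        = ∫⁻ x in Ω, ENNReal.ofReal (ρ x) ^ 2 * ‖u x‖ₑ ^ 4 := by
          refine lintegral_congr fun x => ?_
          rw [ENNReal.ofReal_mul (by positivity), ENNReal.ofReal_pow (hρb x).1,
            ENNReal.ofReal_pow (norm_nonneg _), ofReal_norm]
      _ ≤ 4 * ENNReal.ofReal ρs * A ^ 2 * (∫⁻ x in Ω, ENNReal.ofReal (ρ x) * ‖u x‖ₑ ^ 2) +
            16 * ENNReal.ofReal ρs ^ 2 * ∫⁻ x in Ω, b x ^ 4 :=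
          lintegral_sq_mul_pow_four_le hρ.ennreal_ofReal hu.continuous.enorm.measurable hb
            (.of_forall fun x => ENNReal.ofReal_le_ofReal (hρb x).2)
            (ae_restrict_of_forall_mem hopen.measurableSet hub)
      _ ≤ 4 * ENNReal.ofReal ρs * ENNReal.ofReal (C * Real.log (2 + h) * h) * ENNReal.ofReal V +
            16 * ENNReal.ofReal ρs ^ 2 *
              ENNReal.ofReal (C * ((2 + h)⁻¹) ^ 2 * h ^ 2) := by
          rw [hVE]
          exact add_le_add (mul_le_mul' (mul_le_mul' le_rfl hA) le_rfl)
            (mul_le_mul' le_rfl ((setLIntegral_le_lintegral _ _).trans hb4))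
      _ = _ := by
          rw [ENNReal.ofReal_add (by positivity) (by positivity),
            ENNReal.ofReal_mul' hV0,
            ENNReal.ofReal_mul (p := 4 * ρs) (by positivity),
            ENNReal.ofReal_mul (p := 4) (by positivity),
            ENNReal.ofReal_mul (p := 16 * ρs ^ 2) (by positivity),
            ENNReal.ofReal_mul (p := 16) (by positivity), ENNReal.ofReal_pow hρs.le,
            ENNReal.ofReal_ofNat, ENNReal.ofReal_ofNat]
  rw [Real.sqrt_le_iff]
  refine ⟨by positivity, (hmain.trans hX).trans_eq ?_⟩
  rw [mul_pow, mul_pow, mul_pow, Real.sq_sqrt hMpos.le, Real.sq_sqrt hh0, Real.sq_sqrt hL0]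
  ring
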